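/- Let l ≥ 1 be an integer and q a prime. Define a weighted partition of l as a triple (r, i, γ) with r ≥ 1, i ∈ {1,...,l}^r strictly increasing, γ ∈ (ℕ_{>0})^r, and γ_1 i_1 + ... + γ_r i_r = l. Let p be a prime and (c_k)_{k≥2} a sequence of complex numbers such that the Dirichlet series Σ_{k≥2} c_k k^{-s} converges absolutely in some half-plane. Write formally p^{-Σ_{k≥2} c_k k^{-s}} = Σ_{k≥1} α_k(c) k^{-s}. Then α_{q^l}(c) = -c_{q^l} log p + Σ over weighted partitions (r,i,γ) of l with i_r < l of u(p,l,r,i,γ) · (c_{q^{i_1}})^{γ_1} ⋯ (c_{q^{i_r}})^{γ_r}, where u(p,l,r,i,γ) = (-1)^{γ_1+...+γ_r}/(γ_1! ⋯ γ_r!) · (log p)^{γ_1+...+γ_r}. -/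

import Mathlib

open LSeries in
lemma aux_summable (f : ℕ → ℂ) (hf : f 0 = 0) (σ₀ : ℝ)
    (h : ∀ s : ℂ, σ₀ < s.re → Summable fun k : ℕ => ‖f k‖ * (k : ℝ) ^ (-s.re)) :
    abscissaOfAbsConv f ≤ σ₀ := by
  refine abscissaOfAbsConv_le_of_forall_lt_LSeriesSummable fun y hy => ?_
  have h1 := h (y : ℂ) (by simpa using hy)
  refine Summable.of_norm ?_
  refine h1.congr fun k => ?_
  rcases eq_or_ne k 0 with rfl | hk
  · simp [hf]
  · rw [term_def₀ hf, norm_mul, Complex.norm_natCast_cpow_of_pos (Nat.pos_of_ne_zero hk)]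
    simp

open LSeries Filter in
lemma aux_rec (b α : ℕ → ℂ) (σ : ℝ) (hb : abscissaOfAbsConv b ≤ σ)
    (ha : abscissaOfAbsConv α ≤ σ)
    (heq : ∀ s : ℂ, σ < s.re → Complex.exp (LSeries b s) = LSeries α s) {n : ℕ} (hn : n ≠ 0) :
    logMul α n = convolution (logMul b) α n := by
  have hlt : (σ : EReal) < ⊤ := EReal.coe_lt_top σ
  refine eq_of_LSeries_eventually_eq (f := logMul α) (g := convolution (logMul b) α) ?_ ?_ ?_ hn
  · rw [abscissaOfAbsConv_logMul]; exact ha.trans_lt hlt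
  · refine (abscissaOfAbsConv_convolution_le _ _).trans_lt ?_
    rw [abscissaOfAbsConv_logMul]
    exact (max_le hb ha).trans_lt hlt
  · filter_upwards [eventually_gt_atTop σ] with x hx
    have hx' : (σ : EReal) < ((x : ℂ).re : EReal) := by simpa using hx
    have hbx := hb.trans_lt hx'
    have hax := ha.trans_lt hx'
    rw [LSeries_convolution (by rwa [abscissaOfAbsConv_logMul]) hax]
    have d1 := (LSeries_hasDerivAt hbx).cexp
    have d2 := LSeries_hasDerivAt hax
    have e : LSeries α =ᶠ[nhds (x : ℂ)] fun s => Complex.exp (LSeries b s) := by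
      have : {s : ℂ | σ < s.re} ∈ nhds (x : ℂ) :=
        (isOpen_lt continuous_const Complex.continuous_re).mem_nhds (by simpa using hx)
      filter_upwards [this] with s hs using (heq s hs).symm
    have d3 := (d1.congr_of_eventuallyEq e).unique d2
    rw [heq _ (by simpa using hx)] at d3
    have := neg_inj.1 (d3.symm.trans (mul_neg _ _))
    rw [this, mul_comm]

open LSeries Filter in
lemma aux_one (b α : ℕ → ℂ) (σ : ℝ) (hb : abscissaOfAbsConv b ≤ σ)
    (ha : abscissaOfAbsConv α ≤ σ) (hb1 : b 1 = 0)
    (heq : ∀ s : ℂ, σ < s.re → Complex.exp (LSeries b s) = LSeries α s) : α 1 = 1 := by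
  have hlt : (σ : EReal) < ⊤ := EReal.coe_lt_top σ
  have t1 := (LSeries.tendsto_atTop (ha.trans_lt hlt))
  have t2 := (Complex.continuous_exp.tendsto _).comp (LSeries.tendsto_atTop (hb.trans_lt hlt))
  rw [hb1, Complex.exp_zero] at t2
  refine tendsto_nhds_unique t1 (t2.congr' ?_)
  filter_upwards [eventually_gt_atTop σ] with x hx using heq _ (by simpa using hx)

open LSeries in
lemma aux_rec_q (b α : ℕ → ℂ) (q : ℕ) (hq : q.Prime)
    (h : ∀ n : ℕ, n ≠ 0 → logMul α n = convolution (logMul b) α n) (n : ℕ) :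
    (n : ℂ) * α (q ^ n) =
      ∑ i ∈ Finset.range n, ((i : ℂ) + 1) * b (q ^ (i + 1)) * α (q ^ (n - (i + 1))) := by
  have h1 := h (q ^ n) (pow_ne_zero _ hq.ne_zero)
  have hlog : ∀ m : ℕ, Complex.log ((q ^ m : ℕ) : ℂ) = m * (Real.log q : ℂ) := by
    intro m
    rw [← Complex.natCast_log, Nat.cast_pow, Real.log_pow]
    push_cast; rfl
  have hL : (Real.log q : ℂ) ≠ 0 := by
    have := Real.log_pos (by exact_mod_cast hq.one_lt : (1 : ℝ) < q)
    exact_mod_cast this.ne'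
  rw [convolution_def] at h1
  simp only [logMul] at h1
  rw [Nat.sum_divisorsAntidiagonal (f := fun i j => Complex.log (i : ℂ) * b i * α j),
    Nat.sum_divisors_prime_pow hq, Finset.sum_range_succ', hlog] at h1
  simp only [hlog] at h1
  have h2 : ∀ i ∈ Finset.range n, ((i + 1 : ℕ) : ℂ) * (Real.log q : ℂ) * b (q ^ (i + 1)) *
      α (q ^ n / q ^ (i + 1)) =
      (Real.log q : ℂ) * (((i : ℂ) + 1) * b (q ^ (i + 1)) * α (q ^ (n - (i + 1)))) := by
    intro i hi
    rw [Nat.pow_div (by simpa using hi) hq.pos]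
    push_cast; ring
  rw [Finset.sum_congr rfl h2, ← Finset.mul_sum] at h1
  apply mul_left_cancel₀ hL
  rw [← mul_assoc, mul_comm (Real.log q : ℂ), h1]
  simp

/-- weight of a multiplicity function -/
def auxWt {l : ℕ} (g : Fin l → ℕ) : ℕ := ∑ j : Fin l, (j.1 + 1) * g j

/-- multiplicity functions of weight n -/
def auxS (l n : ℕ) : Finset (Fin l → ℕ) :=
  (Fintype.piFinset fun _ => Finset.range (n + 1)).filter fun g => auxWt g = n

lemma aux_le_wt {l : ℕ} (g : Fin l → ℕ) (j : Fin l) : (j.1 + 1) * g j ≤ auxWt g :=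
  Finset.single_le_sum (f := fun j : Fin l => (j.1 + 1) * g j) (fun _ _ => Nat.zero_le _)
    (Finset.mem_univ j)

lemma mem_auxS {l n : ℕ} (g : Fin l → ℕ) : g ∈ auxS l n ↔ auxWt g = n := by
  simp only [auxS, Finset.mem_filter, Fintype.mem_piFinset, Finset.mem_range,
    and_iff_right_iff_imp]
  intro h j
  have := aux_le_wt g j
  nlinarith

/-- term -/
noncomputable def auxW {l : ℕ} (b : ℕ → ℂ) (g : Fin l → ℕ) : ℂ :=
  ∏ j : Fin l, b j.1 ^ g j / (Nat.factorial (g j) : ℂ)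

lemma auxWt_add {l : ℕ} (g : Fin l → ℕ) (j : Fin l) :
    auxWt (g + Pi.single j 1) = auxWt g + (j.1 + 1) := by
  simp [auxWt, mul_add, Finset.sum_add_distrib, Pi.single_apply]

lemma auxW_add {l : ℕ} (b : ℕ → ℂ) (g : Fin l → ℕ) (j : Fin l) :
    ((g j : ℂ) + 1) * auxW b (g + Pi.single j 1) = b j.1 * auxW b g := by
  unfold auxW
  rw [← Finset.mul_prod_erase _ _ (Finset.mem_univ j),
    ← Finset.mul_prod_erase (a := j) _ (fun j : Fin l => b j.1 ^ g j / (Nat.factorial (g j) : ℂ))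
      (Finset.mem_univ j)]
  have : ∀ i ∈ Finset.univ.erase j, b i.1 ^ (g + Pi.single j 1 : Fin l → ℕ) i /
      (Nat.factorial ((g + Pi.single j 1 : Fin l → ℕ) i) : ℂ)
      = b i.1 ^ g i / (Nat.factorial (g i) : ℂ) := by
    intro i hi
    simp [Finset.ne_of_mem_erase hi]
  rw [Finset.prod_congr rfl this, ← mul_assoc, ← mul_assoc]
  congr 1
  have h1 : ((g j : ℂ) + 1) ≠ 0 := Nat.cast_add_one_ne_zero _
  have h2 : (Nat.factorial (g j) : ℂ) ≠ 0 := by exact_mod_cast Nat.factorial_ne_zero _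
  simp only [Pi.add_apply, Pi.single_eq_same, Nat.factorial_succ, pow_succ]
  push_cast
  field_simp

lemma aux_sub_add {l : ℕ} (g : Fin l → ℕ) (j : Fin l) (h : g j ≠ 0) :
    (g - Pi.single j 1) + Pi.single j 1 = g := by
  ext i
  rcases eq_or_ne i j with rfl | hi
  · simp; omega
  · simp [hi]

lemma aux_shift {l n : ℕ} (b : ℕ → ℂ) (j : Fin l) (hj : j.1 + 1 ≤ n) :
    ∑ g ∈ auxS l n, (g j : ℂ) * auxW b g = b j.1 * ∑ g ∈ auxS l (n - (j.1 + 1)), auxW b g := by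
  rw [Finset.mul_sum]
  rw [← Finset.sum_filter_of_ne (p := fun g : Fin l → ℕ => g j ≠ 0)]
  · symm
    refine Finset.sum_bij' (fun g _ => g + Pi.single j 1) (fun g _ => g - Pi.single j 1)
      ?_ ?_ ?_ ?_ ?_
    · intro g hg
      rw [mem_auxS] at hg
      simp only [Finset.mem_filter, mem_auxS, auxWt_add, hg]
      refine ⟨by omega, by simp⟩
    · intro g hg
      simp only [Finset.mem_filter, mem_auxS] at hg
      rw [mem_auxS]
      have := auxWt_add (g - Pi.single j 1) j
      rw [aux_sub_add g j hg.2] at this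
      omega
    · intro g _
      simp
    · intro g hg
      exact aux_sub_add g j (Finset.mem_filter.1 hg).2
    · intro g _
      rw [← auxW_add]
      simp
  · intro g _ h h0
    simp [h0] at h

lemma aux_F_rec {l n : ℕ} (hn : n ≤ l) (b : ℕ → ℂ) :
    (n : ℂ) * ∑ g ∈ auxS l n, auxW b g =
      ∑ i ∈ Finset.range n, ((i : ℂ) + 1) * b i * ∑ g ∈ auxS l (n - (i + 1)), auxW b g := by
  have h1 : (n : ℂ) * ∑ g ∈ auxS l n, auxW b g =
      ∑ j : Fin l, ((j.1 : ℂ) + 1) * ∑ g ∈ auxS l n, (g j : ℂ) * auxW b g := by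
    simp only [Finset.mul_sum]
    rw [Finset.sum_comm]
    refine Finset.sum_congr rfl fun g hg => ?_
    rw [mem_auxS] at hg
    rw [← hg, auxWt]
    push_cast
    rw [Finset.sum_mul]
    exact Finset.sum_congr rfl fun j _ => by ring
  rw [h1]
  have h2 : ∀ j : Fin l, ((j.1 : ℂ) + 1) * ∑ g ∈ auxS l n, (g j : ℂ) * auxW b g =
      (fun i : ℕ => if i < n then
        ((i : ℂ) + 1) * b i * ∑ g ∈ auxS l (n - (i + 1)), auxW b g else 0) j.1 := by
    intro j
    dsimp only
    split_ifs with h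
    · rw [aux_shift b j h]; ring
    · rw [Finset.sum_eq_zero, mul_zero]
      intro g hg
      rw [mem_auxS] at hg
      have := aux_le_wt g j
      have : g j = 0 := by
        by_contra h0
        have : 1 ≤ g j := Nat.one_le_iff_ne_zero.2 h0
        nlinarith
      simp [this]
  rw [Finset.sum_congr rfl fun j _ => h2 j, Fin.sum_univ_eq_sum_range (fun i : ℕ => if i < n then
        ((i : ℂ) + 1) * b i * ∑ g ∈ auxS l (n - (i + 1)), auxW b g else 0) l, ← Finset.sum_filter]
  refine Finset.sum_congr ?_ fun _ _ => rfl
  ext i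
  simp only [Finset.mem_filter, Finset.mem_range]
  omega

lemma aux_main (l : ℕ) (a b : ℕ → ℂ) (h0 : a 0 = 1)
    (h : ∀ n : ℕ, (n : ℂ) * a n =
      ∑ i ∈ Finset.range n, ((i : ℂ) + 1) * b i * a (n - (i + 1))) (n : ℕ) (hn : n ≤ l) :
    a n = ∑ g ∈ auxS l n, auxW b g := by
  induction n using Nat.strong_induction_on with
  | _ n ih =>
    rcases eq_or_ne n 0 with rfl | hne
    · have : auxS l 0 = {0} := by
        ext g
        rw [mem_auxS, Finset.mem_singleton]
        simp [auxWt, funext_iff]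
      simp [this, h0, auxW]
    · apply mul_left_cancel₀ (Nat.cast_ne_zero.2 hne : (n : ℂ) ≠ 0)
      rw [h, aux_F_rec hn]
      refine Finset.sum_congr rfl fun i hi => ?_
      rw [Finset.mem_range] at hi
      rw [ih (n - (i + 1)) (by omega) (by omega)]


/-- Coefficient formula at prime powers for `p^{-g(s)}` where
`g(s) = Σ_{k≥2} c_k k^{-s}` is a Dirichlet series with finite abscissa of absolute
convergence: if `p^{-g(s)} = Σ α_k k^{-s}` (absolutely convergent in a half-plane),
then for a prime `q` and `l ≥ 1`,
`α_{q^l} = -c_{q^l} log p + Σ_{(r,i,γ)∈WP_l, i_r<l} u(p,l,r,i,γ) Π (c_{q^{i_m}})^{γ_m}`,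
where weighted partitions are encoded by multiplicity functions `g : Fin l → ℕ`
(`g j` is the multiplicity of the part `j+1`), the condition `i_r < l` corresponds to
`g` vanishing on the part `l`, and
`u = (-1)^{Σγ} (log p)^{Σγ} / Π γ_m!`. -/
theorem exponential_coefficient_prime_power
    (l : ℕ) (hl : 1 ≤ l) (p q : ℕ) (hp : p.Prime) (hq : q.Prime)
    (c : ℕ → ℂ) (hc : ∀ k ≤ 1, c k = 0)
    (α : ℕ → ℂ) (hα0 : α 0 = 0) (σ₀ : ℝ)
    (hcconv : ∀ s : ℂ, σ₀ < s.re → Summable fun k : ℕ => ‖c k‖ * (k : ℝ) ^ (-s.re))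
    (hαconv : ∀ s : ℂ, σ₀ < s.re → Summable fun k : ℕ => ‖α k‖ * (k : ℝ) ^ (-s.re))
    (heq : ∀ s : ℂ, σ₀ < s.re →
      (p : ℂ) ^ (-(∑' k : ℕ, c k * (k : ℂ) ^ (-s)))
        = ∑' k : ℕ, α k * (k : ℂ) ^ (-s)) :
    α (q ^ l)
      = -(c (q ^ l)) * (Real.log p : ℂ)
        + ∑' g : Fin l → ℕ,
            if (∑ j : Fin l, (j.1 + 1) * g j = l) ∧ g ⟨l - 1, by omega⟩ = 0 then
              ((-1 : ℂ) ^ (∑ j, g j) / ∏ j, (Nat.factorial (g j) : ℂ))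
                * (Real.log p : ℂ) ^ (∑ j, g j)
                * ∏ j : Fin l, (c (q ^ (j.1 + 1))) ^ (g j)
            else 0 := by


  have hc0 := hc 0 (by norm_num)
  have hp0 : (p : ℂ) ≠ 0 := by exact_mod_cast hp.ne_zero
  have hAc := aux_summable c hc0 σ₀ hcconv
  have hAα := aux_summable α hα0 σ₀ hαconv
  set L : ℂ := (Real.log p : ℂ) with hL
  let b : ℕ → ℂ := (-L) • c
  have hAb : LSeries.abscissaOfAbsConv b ≤ σ₀ := by
    refine LSeries.abscissaOfAbsConv_le_of_forall_lt_LSeriesSummable fun y hy => ?_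
    refine LSeriesSummable.smul _ (LSeriesSummable_of_abscissaOfAbsConv_lt_re ?_)
    exact hAc.trans_lt (by simpa using hy)
  have heq' : ∀ s : ℂ, σ₀ < s.re → Complex.exp (LSeries b s) = LSeries α s := by
    intro s hs
    have h1 : LSeries c s = ∑' k : ℕ, c k * (k : ℂ) ^ (-s) := by
      simp only [LSeries, LSeries.term_def₀ hc0]
    have h2 : LSeries α s = ∑' k : ℕ, α k * (k : ℂ) ^ (-s) := by
      simp only [LSeries, LSeries.term_def₀ hα0]
    rw [h2, ← heq s hs, ← h1, Complex.cpow_def_of_ne_zero hp0, LSeries_smul,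
      ← Complex.natCast_log, ← hL]
    congr 1; ring
  have hrec := aux_rec_q b α q hq (fun n hn => aux_rec b α σ₀ hAb hAα heq' hn)
  have hone := aux_one b α σ₀ hAb hAα (by simp [b, hc 1 le_rfl]) heq'
  have key := aux_main l (fun n => α (q ^ n)) (fun i => b (q ^ (i + 1))) (by simpa using hone)
    hrec l le_rfl
  have hW : ∀ g : Fin l → ℕ, ((-1 : ℂ) ^ (∑ j, g j) / ∏ j, (Nat.factorial (g j) : ℂ))
                * L ^ (∑ j, g j) * ∏ j : Fin l, (c (q ^ (j.1 + 1))) ^ (g j)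
      = auxW (fun i => b (q ^ (i + 1))) g := by
    intro g
    simp only [auxW, b, Pi.smul_apply, smul_eq_mul, Finset.prod_div_distrib, mul_pow,
      Finset.prod_mul_distrib, Finset.prod_pow_eq_pow_sum, neg_pow L]
    ring
  rw [key, tsum_eq_sum (s := auxS l l)]
  · set j₀ : Fin l := ⟨l - 1, by omega⟩ with hj₀
    have hj1 : j₀.1 + 1 = l := by simp [hj₀]; omega
    have hsing : (Pi.single j₀ 1 : Fin l → ℕ) ∈ auxS l l := by
      rw [mem_auxS]
      have := auxWt_add (0 : Fin l → ℕ) j₀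
      rw [zero_add, hj1] at this
      simpa [auxWt] using this
    rw [← Finset.add_sum_erase _ _ hsing,
      ← Finset.add_sum_erase (a := (Pi.single j₀ 1 : Fin l → ℕ)) _ (fun g => ite _ _ _) hsing]
    have e1 : auxW (fun i => b (q ^ (i + 1))) (Pi.single j₀ 1) = -c (q ^ l) * L := by
      have := auxW_add (fun i => b (q ^ (i + 1))) (0 : Fin l → ℕ) j₀
      rw [zero_add] at this
      simp only [hj1] at this
      simp only [Pi.zero_apply, Nat.cast_zero, zero_add, one_mul] at this
      rw [this]
      simp [auxW, b]; ring
    rw [e1, if_neg (by simp), zero_add]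
    congr 1
    refine Finset.sum_congr rfl fun g hg => ?_
    obtain ⟨hne, hg⟩ := Finset.mem_erase.1 hg
    rw [mem_auxS] at hg
    rw [if_pos, hW]
    refine ⟨hg, ?_⟩
    by_contra h0
    apply hne
    have h1 := auxWt_add (g - Pi.single j₀ 1) j₀
    rw [aux_sub_add g j₀ h0, hg, hj1] at h1
    have h2 : auxWt (g - Pi.single j₀ 1) = 0 := by omega
    have h3 : g - Pi.single j₀ 1 = 0 := by
      ext i
      have := aux_le_wt (g - Pi.single j₀ 1) i
      rw [h2] at this
      simpa using this
    rw [← aux_sub_add g j₀ h0, h3, zero_add]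
  · intro g hg
    rw [mem_auxS] at hg
    exact if_neg fun h => hg h.1
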